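/- arXiv:1307.6233 — 3 statements merged into one kernel-verified Lean document; each statement's English description precedes it below -/
import Mathlib

section
/- Let A be an elongated ribbon, and suppose row i+1 of A is strictly longer than row i for some i. Let A' be the ribbon obtained from A by exchanging the lengths of rows i and i+1 (keeping all other row lengths the same). Then Fsupp(A) = Fsupp(A'). -/
namespace SkewPaper

open Finset

/-- A skew shape `λ/μ`, given by Young diagrams `μ ≤ λ`. -/
structure SkewShape where
  lam : YoungDiagram
  mu : YoungDiagram
  sub : mu ≤ lam

namespace SkewShape

/-- The cells (boxes) of the skew shape `λ/μ`. -/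
def cells (A : SkewShape) : Finset (ℕ × ℕ) :=
  A.lam.cells \ A.mu.cells

/-- The number of boxes of `A`. -/
def size (A : SkewShape) : ℕ := A.cells.card

end SkewShape

/-- The set of columns occupied by row `i` of the cell set `s`. -/
def rowCols (s : Finset (ℕ × ℕ)) (i : ℕ) : Finset ℕ :=
  (s.filter (fun c => c.1 = i)).image Prod.snd

/-- The set of rows occupied by column `j` of the cell set `s`. -/
def colRows (s : Finset (ℕ × ℕ)) (j : ℕ) : Finset ℕ :=
  (s.filter (fun c => c.2 = j)).image Prod.fst

/-- `overlapRow s k i` : the number of columns occupied in common by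
rows `i, i+1, …, i+k-1` of `s`. -/
def overlapRow (s : Finset (ℕ × ℕ)) (k i : ℕ) : ℕ :=
  ((rowCols s i).filter (fun j => ∀ t, t < k → j ∈ rowCols s (i + t))).card

/-- `overlapCol s l j` : the number of rows occupied in common by
columns `j, j+1, …, j+l-1` of `s`. -/
def overlapCol (s : Finset (ℕ × ℕ)) (l j : ℕ) : ℕ :=
  ((colRows s j).filter (fun i => ∀ t, t < l → i ∈ colRows s (j + t))).card

/-- `rows_k`: the partition (as the multiset of its nonzero parts) of overlaps of
`k` consecutive rows. -/
def rowsk (s : Finset (ℕ × ℕ)) (k : ℕ) : Multiset ℕ :=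
  ((s.image Prod.fst).val.map (overlapRow s k)).filter (fun m => 0 < m)

/-- `cols_l`: the partition (as the multiset of its nonzero parts) of overlaps of
`l` consecutive columns. -/
def colsk (s : Finset (ℕ × ℕ)) (l : ℕ) : Multiset ℕ :=
  ((s.image Prod.snd).val.map (overlapCol s l)).filter (fun m => 0 < m)

/-- `rects s k l`: the number of `k × l` rectangles of boxes contained inside `s`. -/
def rects (s : Finset (ℕ × ℕ)) (k l : ℕ) : ℕ :=
  (s.filter (fun c => ∀ a, a < k → ∀ b, b < l → (c.1 + a, c.2 + b) ∈ s)).card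

/-- The weakly decreasing sorted list of a multiset: the partition with those parts. -/
def sortDesc (s : Multiset ℕ) : List ℕ := (s.sort (· ≤ ·)).reverse

/-- Dominance order on partitions presented as multisets of parts:
every partial sum of the decreasing sort of `s` is at most the corresponding
partial sum for `t` (missing parts treated as `0`). -/
def Dom (s t : Multiset ℕ) : Prop :=
  ∀ j : ℕ, ((sortDesc s).take j).sum ≤ ((sortDesc t).take j).sum

/-- The conjugate (transpose) of a partition presented as a multiset of parts. -/
def conjM (s : Multiset ℕ) : Multiset ℕ :=
  (Multiset.range s.sup).map (fun j => Multiset.card (s.filter (fun x => j < x)))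

/-- A standard Young tableau of shape `A`: a bijective filling of the cells of `A`
by `1, …, |A|` which increases from left to right along rows and from top to
bottom down columns.  (Entries off the shape are normalized to `0`.) -/
structure SYT (A : SkewShape) where
  entry : ℕ × ℕ → ℕ
  zero_off : ∀ c, c ∉ A.cells → entry c = 0
  mem_range : ∀ c ∈ A.cells, entry c ∈ Finset.Icc 1 A.size
  injOn : Set.InjOn entry ↑A.cells
  row_lt : ∀ i j j', (i, j) ∈ A.cells → (i, j') ∈ A.cells → j < j' →
    entry (i, j) < entry (i, j')
  col_lt : ∀ i i' j, (i, j) ∈ A.cells → (i', j) ∈ A.cells → i < i' →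
    entry (i, j) < entry (i', j)

/-- The descent set of a standard Young tableau: those `k ∈ {1, …, n-1}` such that
`k+1` appears in a strictly lower row than `k`. -/
def SYT.descentSet {A : SkewShape} (T : SYT A) : Finset ℕ :=
  (Finset.Ico 1 A.size).filter (fun k =>
    ∃ c ∈ A.cells, ∃ c' ∈ A.cells, T.entry c = k ∧ T.entry c' = k + 1 ∧ c.1 < c'.1)

/-- The composition of `n` corresponding to a subset `D ⊆ {1, …, n-1}`:
its partial sums are the elements of `D`. -/
def compOfSet (n : ℕ) (D : Finset ℕ) : List ℕ :=
  if n = 0 then []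
  else
    let l := D.sort (· ≤ ·) ++ [n]
    List.zipWith (fun x y => x - y) l (0 :: l)

/-- The descent composition of a standard Young tableau. -/
def SYT.descentComp {A : SkewShape} (T : SYT A) : List ℕ :=
  compOfSet A.size T.descentSet

/-- The F-support of `A`: the set of descent compositions of SYT of shape `A`. -/
def Fsupp (A : SkewShape) : Set (List ℕ) :=
  {α | ∃ T : SYT A, T.descentComp = α}

/-- The number of standard Young tableaux of shape `A` with descent composition `α`. -/
noncomputable def countSYT (A : SkewShape) (α : List ℕ) : ℕ :=
  Nat.card {T : SYT A // T.descentComp = α}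

/-- `S(γ)`: the set of proper partial sums of the composition `γ`. -/
def Sset (γ : List ℕ) : Finset ℕ :=
  ((List.range (γ.length - 1)).map (fun j => (γ.take (j + 1)).sum)).toFinset

/-- `cols(α)` for a composition `α` of `n`, as a multiset: the parts of the
composition corresponding to the complement of `S(α)` in `{1, …, n-1}`. -/
def colsComp (α : List ℕ) : Multiset ℕ :=
  ↑(compOfSet α.sum ((Finset.Icc 1 (α.sum - 1)) \ Sset α))

/-- Delete the leftmost box of every nonempty row. -/
def trimCells (s : Finset (ℕ × ℕ)) : Finset (ℕ × ℕ) :=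
  s.filter (fun c => 1 ≤ c.2 ∧ (c.1, c.2 - 1) ∈ s)

/-- `s` is a ribbon whose (nonempty) rows are exactly rows `r0, …, r1`, with every
pair of adjacent rows overlapping in exactly one column. -/
def IsRibbonOn (s : Finset (ℕ × ℕ)) (r0 r1 : ℕ) : Prop :=
  r0 ≤ r1 ∧ (∀ i, (rowCols s i).Nonempty ↔ r0 ≤ i ∧ i ≤ r1) ∧
    (∀ i, r0 ≤ i → i < r1 → (rowCols s i ∩ rowCols s (i + 1)).card = 1)

/-- `A` is a ribbon. -/
def SkewShape.IsRibbon (A : SkewShape) : Prop :=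
  ∃ r0 r1, IsRibbonOn A.cells r0 r1

/-- An elongated ribbon: a ribbon all of whose rows have length at least two. -/
def ElongatedRibbon (A : SkewShape) : Prop :=
  A.IsRibbon ∧ ∀ i, (rowCols A.cells i).Nonempty → 2 ≤ (rowCols A.cells i).card

/-- A horizontal strip: at most one box in each column. -/
def IsHorizontalStrip (A : SkewShape) : Prop :=
  ∀ j, (colRows A.cells j).card ≤ 1

/-- `A` is F-multiplicity-free: distinct SYT of shape `A` have distinct descent sets. -/
def FMultFree (A : SkewShape) : Prop :=
  ∀ T T' : SYT A, T.descentSet = T'.descentSet → T = T'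

/-- The cells of a shape, viewed inside `ℤ × ℤ`. -/
def toZ (s : Finset (ℕ × ℕ)) : Finset (ℤ × ℤ) :=
  s.image (fun c => ((c.1 : ℤ), (c.2 : ℤ)))

/-- The cells of the hook `(m, 1^l)`. -/
def hookCells (m l : ℕ) : Finset (ℕ × ℕ) :=
  ((Finset.range m).image (fun j => ((0 : ℕ), j))) ∪
    ((Finset.Icc 1 l).image (fun i => (i, (0 : ℕ))))

/-- `f` assigns to each entry in `{1, …, n}` its row, among `0, …, m`, in a standard filling of a
ribbon with row lengths `ℓ 0, …, ℓ m`: the first entry of each row is smaller than the last entry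
of the next row. -/
structure IsRowLabelling (n m : ℕ) (ℓ f : ℕ → ℕ) : Prop where
  le : ∀ k ∈ Icc 1 n, f k ≤ m
  card : ∀ r ≤ m, ((Icc 1 n).filter (fun k => f k = r)).card = ℓ r
  link : ∀ r < m, ∃ i ∈ Icc 1 n, ∃ j ∈ Icc 1 n, i < j ∧ f i = r ∧ f j = r + 1

/-- The positions `k` in `{1, …, n - 1}` where `f` increases. -/
def ascents (n : ℕ) (f : ℕ → ℕ) : Finset ℕ :=
  (Ico 1 n).filter (fun k => f k < f (k + 1))

lemma exists_upper_subset (S : Finset ℕ) (q : ℕ) (hq : q ≤ S.card) :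
    ∃ C ⊆ S, C.card = q ∧ ∀ x ∈ C, ∀ y ∈ S, x < y → y ∈ C := by
  induction S using Finset.induction_on_min with
  | empty => exact ⟨∅, by simp, by simp at hq; simp [hq], by simp⟩
  | insert a S ha ih =>
    have haS : a ∉ S := fun h => lt_irrefl _ (ha a h)
    rw [card_insert_of_notMem haS] at hq
    rcases hq.lt_or_eq with hlt | rfl
    · obtain ⟨C, hC, hcard, hup⟩ := ih (by omega)
      refine ⟨C, hC.trans (subset_insert _ _), hcard, fun x hx y hy hxy => ?_⟩
      rcases mem_insert.1 hy with rfl | hy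
      · exact absurd (ha x (hC hx)) (by omega)
      · exact hup x hx y hy hxy
    · exact ⟨_, Subset.rfl, card_insert_of_notMem haS, fun _ _ _ hy _ => hy⟩

/-- Moving `ℓ (t + 1) - ℓ t` entries from row `t + 1` up to row `t` without changing the ascents,
while keeping in row `t + 1` a prescribed set `K` of entries, each starting a run of consecutive
entries of row `t + 1`. -/
lemma IsRowLabelling.exists_raise {n m t : ℕ} {ℓ f : ℕ → ℕ} (h : IsRowLabelling n m ℓ f)
    (ht : t < m) (hlt : ℓ t < ℓ (t + 1)) (K : Finset ℕ)
    (hK : ∀ y ∈ K, y ∈ Icc 1 n ∧ f y = t + 1)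
    (hstart : ∀ y ∈ K, y - 1 ∈ Icc 1 n → f (y - 1) ≠ t + 1)
    (hforced : ∀ k ∈ Icc 1 n, k + 1 ∈ Icc 1 n → f k = t → f (k + 1) = t + 1 → k + 1 ∈ K)
    (hcard : K.card ≤ ℓ t) :
    ∃ f' : ℕ → ℕ, ascents n f' = ascents n f ∧
      (∀ k ∈ Icc 1 n, f' k ≤ m) ∧
      (∀ r ≤ m, ((Icc 1 n).filter (fun k => f' k = r)).card = ℓ (Equiv.swap t (t + 1) r)) ∧
      (∀ k, f k ≠ t + 1 → f' k = f k) ∧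
      (∀ k, f k = t + 1 → f' k = t ∨ f' k = t + 1) ∧
      (∀ k ∈ K, f' k = t + 1) := by
  classical
  set X := (Icc 1 n).filter (fun k => f k = t) with hX
  set Y := (Icc 1 n).filter (fun k => f k = t + 1) with hY
  have hXc : X.card = ℓ t := h.card t ht.le
  have hYc : Y.card = ℓ (t + 1) := h.card (t + 1) ht
  have hKY : K ⊆ Y := fun y hy => mem_filter.2 (hK y hy)
  obtain ⟨C, hC, hCcard, hup⟩ := exists_upper_subset (Y \ K) (ℓ (t + 1) - ℓ t)
    (by rw [card_sdiff_of_subset hKY]; omega)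
  have hCY : C ⊆ Y := hC.trans sdiff_subset
  have hCf : ∀ k ∈ C, f k = t + 1 := fun k hk => (mem_filter.1 (hCY hk)).2
  refine ⟨fun k => if k ∈ C then t else f k, ?_, ?_, ?_, ?_, ?_, ?_⟩
  · apply filter_congr
    intro k hk
    rw [mem_Ico] at hk
    have hk1 : k ∈ Icc 1 n := mem_Icc.2 (by omega)
    have hk2 : k + 1 ∈ Icc 1 n := mem_Icc.2 (by omega)
    dsimp only
    by_cases c1 : k ∈ C <;> by_cases c2 : k + 1 ∈ C
    · simp [c1, c2, hCf k c1, hCf _ c2]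
    · have := hCf k c1
      have hne : f (k + 1) ≠ t + 1 := by
        intro he
        refine c2 (hup k c1 (k + 1) (mem_sdiff.2 ⟨mem_filter.2 ⟨hk2, he⟩, fun hkK => ?_⟩) (by omega))
        exact hstart _ hkK (by simpa using hk1) (by simpa using this)
      rw [if_pos c1, if_neg c2]
      omega
    · have := hCf _ c2
      have hne : f k ≠ t := fun he => (mem_sdiff.1 (hC c2)).2 (hforced k hk1 hk2 he this)
      rw [if_neg c1, if_pos c2]
      omega
    · simp [c1, c2]
  · intro k hk
    dsimp only
    split_ifs
    · exact ht.le
    · exact h.le k hk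
  · intro r hr
    by_cases hrt : r = t
    · subst hrt
      rw [Equiv.swap_apply_left]
      have : ((Icc 1 n).filter (fun k => (if k ∈ C then r else f k) = r)) = X ∪ C := by
        ext k
        have : k ∈ C → k ∈ Icc 1 n := fun hk => (mem_filter.1 (hCY hk)).1
        by_cases c : k ∈ C <;> simp_all
      rw [this, card_union_of_disjoint, hXc, hCcard]
      · omega
      · rw [disjoint_left]
        intro k hk hk'
        have := hCf k hk'
        have := (mem_filter.1 hk).2
        omega
    · by_cases hrt' : r = t + 1
      · subst hrt'
        rw [Equiv.swap_apply_right]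
        have : ((Icc 1 n).filter (fun k => (if k ∈ C then t else f k) = t + 1)) = Y \ C := by
          ext k
          by_cases c : k ∈ C <;> simp [c, hY]
        rw [this, card_sdiff_of_subset hCY, hCcard, hYc]
        omega
      · rw [Equiv.swap_apply_of_ne_of_ne hrt hrt', ← h.card r hr]
        congr 1
        apply filter_congr
        intro k _
        dsimp only
        by_cases c : k ∈ C
        · have := hCf k c
          rw [if_pos c]
          omega
        · rw [if_neg c]
  · intro k hk
    exact if_neg fun c => hk (hCf k c)
  · intro k hk
    dsimp only
    split_ifs <;> simp [hk]
  · intro k hk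
    dsimp only
    rw [if_neg fun c => (mem_sdiff.1 (hC c)).2 hk]
    exact (hK k hk).2

/-- If all entries of row `t + 2` are smaller than all entries of row `t + 1`, then exchanging two
entries links these rows without changing the ascents. -/
lemma exists_isRowLabelling_of_unlinked {n m t : ℕ} {ℓ f : ℕ → ℕ} (htm : t + 1 < m)
    (hle : ∀ k ∈ Icc 1 n, f k ≤ m)
    (hcard : ∀ r ≤ m, ((Icc 1 n).filter (fun k => f k = r)).card = ℓ r)
    (htwo : 2 ≤ ℓ (t + 2))
    (hlink : ∀ r < m, r ≠ t → r ≠ t + 1 →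
      ∃ i ∈ Icc 1 n, ∃ j ∈ Icc 1 n, i < j ∧ f i = r ∧ f j = r + 1)
    (hunlinked : ∀ y ∈ Icc 1 n, f y = t + 1 → ∀ z ∈ Icc 1 n, f z = t + 2 → z < y)
    (hlow : ∃ i ∈ Icc 1 n, ∃ j ∈ Icc 1 n, i < j ∧ f i = t ∧ f j = t + 2)
    (hpred : ∃ q ∈ Icc 1 n, f q = t + 1 ∧ f (q - 1) = t) :
    ∃ g, IsRowLabelling n m ℓ g ∧ ascents n g = ascents n f := by
  classical
  obtain ⟨y, hy, w₁, hw₁, hyw₁, hfy, hfw₁⟩ := hlow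
  obtain ⟨q, hq, hfq, hfq'⟩ := hpred
  set W := (Icc 1 n).filter (fun k => f k = t + 2)
  have hWne : W.Nonempty := ⟨w₁, mem_filter.2 ⟨hw₁, hfw₁⟩⟩
  obtain ⟨hw, hfw⟩ := mem_filter.1 (max'_mem W hWne)
  have hwmax := fun z hz => le_max' W z hz
  set w := W.max' hWne
  have hlast := hwmax w₁ (mem_filter.2 ⟨hw₁, hfw₁⟩)
  have hwq := hunlinked q hq hfq w hw hfw
  set g : ℕ → ℕ := fun k => f (Equiv.swap w q k) with hg
  have hgw : g w = t + 1 := by simp [hg, hfq]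
  have hgq : g q = t + 2 := by simp [hg, hfw]
  have hgo : ∀ k, k ≠ w → k ≠ q → g k = f k := by
    intro k h1 h2
    simp [hg, Equiv.swap_apply_of_ne_of_ne h1 h2]
  have hgo' : ∀ k, f k ≠ t + 1 → f k ≠ t + 2 → g k = f k := by
    intro k h1 h2
    refine hgo k ?_ ?_ <;> rintro rfl <;> contradiction
  have hmaps : ∀ k ∈ Icc 1 n, Equiv.swap w q k ∈ Icc 1 n := by
    intro k hk
    rw [Equiv.swap_apply_def]
    split_ifs <;> assumption
  refine ⟨g, ⟨fun k hk => hle _ (hmaps k hk), fun r hr => ?_, fun r hr => ?_⟩, ?_⟩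
  · rw [← hcard r hr]
    refine card_bij (fun k _ => Equiv.swap w q k) ?_ ?_ ?_
    · intro k hk
      rw [mem_filter] at hk ⊢
      exact ⟨hmaps k hk.1, hk.2⟩
    · intro a _ b _ hab
      exact (Equiv.swap w q).injective hab
    · intro k hk
      rw [mem_filter] at hk
      exact ⟨Equiv.swap w q k, mem_filter.2 ⟨hmaps k hk.1, by simp [hg, hk.2]⟩, by simp⟩
  · by_cases hr1 : r = t
    · subst hr1
      exact ⟨y, hy, w, hw, by omega, by rw [hgo' y (by omega) (by omega), hfy], hgw⟩
    · by_cases hr2 : r = t + 1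
      · subst hr2
        exact ⟨w, hw, q, hq, hwq, hgw, hgq⟩
      · obtain ⟨i, hi, j, hj, hij, hfi, hfj⟩ := hlink r hr hr1 hr2
        by_cases hr3 : r = t + 2
        · subst hr3
          have hgj := hgo' j (by omega) (by omega)
          by_cases hiw : i = w
          · have hW2 : 1 < W.card := by
              rw [hcard (t + 2) hr.le]
              exact htwo
            obtain ⟨z, hz, hzw⟩ := exists_mem_ne hW2 w
            have hz' := mem_filter.1 hz
            have hzle := hwmax z hz
            refine ⟨z, hz'.1, j, hj, by omega, ?_, by rw [hgj, hfj]⟩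
            rw [hgo z hzw (by omega), hz'.2]
          · refine ⟨i, hi, j, hj, hij, ?_, by rw [hgj, hfj]⟩
            rw [hgo i hiw (by rintro rfl; omega), hfi]
        · exact ⟨i, hi, j, hj, hij, by rw [hgo' i (by omega) (by omega), hfi],
            by rw [hgo' j (by omega) (by omega), hfj]⟩
  · apply filter_congr
    intro k hk
    rw [mem_Ico] at hk
    have hk1 : k ∈ Icc 1 n := mem_Icc.2 (by omega)
    have hk2 : k + 1 ∈ Icc 1 n := mem_Icc.2 (by omega)
    by_cases e1 : k = w
    · have hne : k + 1 ≠ q := by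
        rintro rfl
        rw [Nat.add_sub_cancel, e1] at hfq'
        omega
      have hne2 : f (k + 1) ≠ t + 2 := by
        intro he
        have := hwmax (k + 1) (mem_filter.2 ⟨hk2, he⟩)
        omega
      rw [hgo (k + 1) (by omega) hne, e1, hgw, hfw, ← e1]
      omega
    · by_cases e2 : k = q
      · have hne2 : f (k + 1) ≠ t + 2 := by
          intro he
          have := hunlinked q hq hfq (k + 1) hk2 he
          omega
        rw [hgo (k + 1) (by omega) (by omega), e2, hgq, hfq, ← e2]
        omega
      · rw [hgo k e1 e2]
        by_cases e3 : k + 1 = w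
        · have hne2 : f k ≠ t + 1 := by
            intro he
            have := hunlinked k hk1 he w hw hfw
            omega
          rw [e3, hgw, hfw]
          omega
        · by_cases e4 : k + 1 = q
          · have : k = q - 1 := by omega
            rw [e4, hgq, hfq, this, hfq']
            omega
          · rw [hgo _ e3 e4]

/-- If the row `t + 1` is longer than the row `t`, the two row lengths can be exchanged. -/
lemma IsRowLabelling.exists_swap_of_lt {n m t : ℕ} {ℓ f : ℕ → ℕ} (h : IsRowLabelling n m ℓ f)
    (ht : t < m) (htwo : ∀ r ≤ m, 2 ≤ ℓ r) (hlt : ℓ t < ℓ (t + 1)) :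
    ∃ f', IsRowLabelling n m (fun r => ℓ (Equiv.swap t (t + 1) r)) f' ∧
      ascents n f' = ascents n f := by
  classical
  set X := (Icc 1 n).filter (fun k => f k = t) with hX
  set Y := (Icc 1 n).filter (fun k => f k = t + 1) with hY
  have hXc : X.card = ℓ t := h.card t ht.le
  -- the entries of row `t + 1` directly following an entry of row `t`
  set M := Y.filter (fun y => y - 1 ∈ X) with hM
  have hMmem : ∀ y, y ∈ M ↔ y ∈ Icc 1 n ∧ f y = t + 1 ∧ y - 1 ∈ Icc 1 n ∧ f (y - 1) = t := by
    intro y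
    simp only [hM, hX, hY, mem_filter, and_assoc]
  have hMX : M.image (fun y => y - 1) ⊆ X := by
    intro x hx
    obtain ⟨y, hy, rfl⟩ := mem_image.1 hx
    exact (mem_filter.1 hy).2
  have hMinj : Set.InjOn (fun y => y - 1) (M : Set ℕ) := by
    intro x hx y hy hxy
    have h1 := (mem_Icc.1 ((hMmem x).1 hx).1).1
    have h2 := (mem_Icc.1 ((hMmem y).1 hy).1).1
    dsimp only at hxy
    omega
  have hMcard : M.card ≤ ℓ t := by
    rw [← hXc, ← card_image_of_injOn hMinj]
    exact card_le_card hMX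
  -- an entry of row `t + 1` that can be kept to link rows `t` and `t + 1`
  obtain ⟨ys, hysY, hysstart, ⟨xs, hxs, hxsys⟩, hyscard⟩ : ∃ ys ∈ Y,
      (ys - 1 ∈ Icc 1 n → f (ys - 1) ≠ t + 1) ∧ (∃ x ∈ X, x < ys) ∧
      (insert ys M).card ≤ max M.card 1 := by
    rcases M.eq_empty_or_nonempty with hM0 | ⟨y, hy⟩
    · obtain ⟨i, hi, j, hj, hij, hfi, hfj⟩ := h.link t ht
      have hne : (Y.filter (fun y => i < y)).Nonempty := 
        ⟨j, mem_filter.2 ⟨mem_filter.2 ⟨hj, hfj⟩, hij⟩⟩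
      have hmin := min'_mem _ hne
      have hle := fun z hz => min'_le (Y.filter (fun y => i < y)) z hz
      set y := (Y.filter (fun y => i < y)).min' hne
      rw [mem_filter] at hmin
      refine ⟨y, hmin.1, fun h1 h2 => ?_, ⟨i, mem_filter.2 ⟨hi, hfi⟩, hmin.2⟩, by simp [hM0]⟩
      by_cases hyi : y - 1 = i
      · rw [hyi] at h2
        omega
      · have := hle (y - 1) (mem_filter.2 ⟨mem_filter.2 ⟨h1, h2⟩, by omega⟩)
        omega
    · have hy' := (hMmem y).1 hy
      refine ⟨y, mem_of_mem_filter y hy, fun _ => by omega, ⟨y - 1, (mem_filter.1 hy).2, ?_⟩, ?_⟩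
      · have := (mem_Icc.1 hy'.1).1
        omega
      · rw [insert_eq_of_mem hy]
        exact le_max_left _ _
  have hysM : M.card = ℓ t → ys ∈ M := by
    intro he
    by_contra hn
    rw [card_insert_of_notMem hn] at hyscard
    have := htwo t ht.le
    omega
  have hlow : ∀ (f' : ℕ → ℕ), (∀ k, f k ≠ t + 1 → f' k = f k) → ∀ r < m, r ≠ t → r ≠ t + 1 →
      ∃ i ∈ Icc 1 n, ∃ j ∈ Icc 1 n, i < j ∧ f' i = r ∧ f' j = r + 1 := by
    intro f' hf' r hr hr1 hr2
    obtain ⟨i, hi, j, hj, hij, hfi, hfj⟩ := h.link r hr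
    exact ⟨i, hi, j, hj, hij, by rw [hf' i (by omega), hfi], by rw [hf' j (by omega), hfj]⟩
  have hforcedM : ∀ k ∈ Icc 1 n, k + 1 ∈ Icc 1 n → f k = t → f (k + 1) = t + 1 → k + 1 ∈ M := by
    intro k hk hk' h1 h2
    exact (hMmem _).2 ⟨hk', h2, by simpa using hk, by simpa using h1⟩
  have htwo' := htwo t ht.le
  by_cases hp : M.card = ℓ t
  · obtain ⟨f', hasc, hle, hcard, hout, hin, hkeep⟩ := h.exists_raise ht hlt M
      (fun y hy => ⟨((hMmem y).1 hy).1, ((hMmem y).1 hy).2.1⟩)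
      (fun y hy _ => by have := ((hMmem y).1 hy).2.2.2; omega) hforcedM hMcard
    have hys := hysM hp
    have hlinkt : ∃ i ∈ Icc 1 n, ∃ j ∈ Icc 1 n, i < j ∧ f' i = t ∧ f' j = t + 1 := by
      rw [mem_filter] at hxs hysY
      exact ⟨xs, hxs.1, ys, hysY.1, hxsys, by rw [hout xs (by omega), hxs.2], hkeep ys hys⟩
    -- `M` is all of the new row `t + 1`
    have hrow : ∀ k ∈ Icc 1 n, f' k = t + 1 → k ∈ M := by
      have hsub : M ⊆ (Icc 1 n).filter (fun k => f' k = t + 1) := fun y hy =>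
        mem_filter.2 ⟨((hMmem y).1 hy).1, hkeep y hy⟩
      have := eq_of_subset_of_card_le hsub
        (by rw [hcard (t + 1) ht, Equiv.swap_apply_right, hp])
      intro k hk hk'
      rw [this]
      exact mem_filter.2 ⟨hk, hk'⟩
    by_cases hgood : t + 1 < m → ∃ y ∈ M, ∃ w ∈ Icc 1 n, f w = t + 2 ∧ y < w
    · refine ⟨f', ⟨hle, hcard, fun r hr => ?_⟩, hasc⟩
      by_cases hr1 : r = t
      · subst hr1
        exact hlinkt
      · by_cases hr2 : r = t + 1
        · subst hr2
          obtain ⟨y, hy, w, hw, hfw, hyw⟩ := hgood hr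
          exact ⟨y, ((hMmem y).1 hy).1, w, hw, hyw, hkeep y hy, by rw [hout w (by omega), hfw]⟩
        · exact hlow f' hout r hr hr1 hr2
    · push Not at hgood
      obtain ⟨htm, hgood⟩ := hgood
      obtain ⟨y₁, hy₁, w₁, hw₁, hyw₁, hfy₁, hfw₁⟩ := h.link (t + 1) htm
      have hysM' := (hMmem ys).1 hys
      have hWM : ∀ y ∈ M, ∀ z ∈ Icc 1 n, f z = t + 2 → z < y := by
        intro y hy z hz hfz
        have h1 := hgood y hy z hz hfz
        have h2 : z ≠ y := by
          rintro rfl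
          have := ((hMmem z).1 hy).2.1
          omega
        omega
      have hfy₁' : f' y₁ = t := by
        rcases hin y₁ hfy₁ with h1 | h1
        · exact h1
        · have := hWM y₁ (hrow y₁ hy₁ h1) w₁ hw₁ hfw₁
          omega
      have hf'2 : ∀ k, f' k = t + 2 → f k = t + 2 := by
        intro k hk
        by_cases hk' : f k = t + 1
        · rcases hin k hk' with h1 | h1 <;> omega
        · rw [← hout k hk', hk]
      obtain ⟨g, hg, hgasc⟩ := exists_isRowLabelling_of_unlinked htm hle hcard
        (by
          rw [Equiv.swap_apply_of_ne_of_ne (by omega) (by omega)]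
          exact htwo _ htm)
        (hlow f' hout)
        (fun y hy hfy z hz hfz => hWM y (hrow y hy hfy) z hz (hf'2 z hfz))
        ⟨y₁, hy₁, w₁, hw₁, hyw₁, hfy₁', by rw [hout w₁ (by omega), hfw₁]⟩
        ⟨ys, hysM'.1, hkeep ys hys, by rw [hout _ (by omega), hysM'.2.2.2]⟩
      exact ⟨g, hg, hgasc.trans hasc⟩
  · have hYne : Y.Nonempty := ⟨ys, hysY⟩
    have hmin := mem_filter.1 (min'_mem Y hYne)
    have hmin_le := fun z hz => min'_le Y z hz
    set y₀ := Y.min' hYne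
    have hysY' := mem_filter.1 hysY
    have hxs' := mem_filter.1 hxs
    obtain ⟨f', hasc, hle, hcard, hout, -, hkeep⟩ := h.exists_raise ht hlt
      (insert y₀ (insert ys M))
      (by
        intro y hy
        rw [mem_insert, mem_insert] at hy
        rcases hy with rfl | rfl | hy
        · exact hmin
        · exact hysY'
        · exact ⟨((hMmem y).1 hy).1, ((hMmem y).1 hy).2.1⟩)
      (by
        intro y hy
        rw [mem_insert, mem_insert] at hy
        rcases hy with rfl | rfl | hy
        · intro h1 h2
          have := hmin_le _ (mem_filter.2 ⟨h1, h2⟩)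
          rw [mem_Icc] at h1
          omega
        · exact hysstart
        · have := ((hMmem y).1 hy).2.2.2
          omega)
      (fun k hk hk' h1 h2 => mem_insert_of_mem (mem_insert_of_mem (hforcedM k hk hk' h1 h2)))
      (by
        have := card_insert_le y₀ (insert ys M)
        omega)
    refine ⟨f', ⟨hle, hcard, fun r hr => ?_⟩, hasc⟩
    by_cases hr1 : r = t
    · subst hr1
      exact ⟨xs, hxs'.1, ys, hysY'.1, hxsys, by rw [hout xs (by omega), hxs'.2],
        hkeep ys (by simp)⟩
    · by_cases hr2 : r = t + 1
      · subst hr2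
        obtain ⟨y, hy, w, hw, hyw, hfy, hfw⟩ := h.link (t + 1) hr
        have := hmin_le y (mem_filter.2 ⟨hy, hfy⟩)
        exact ⟨y₀, hmin.1, w, hw, by omega, hkeep y₀ (by simp), by rw [hout w (by omega), hfw]⟩
      · exact hlow f' hout r hr hr1 hr2

/-- Rotating a ribbon filling by a half turn. -/
lemma IsRowLabelling.rotate {n m : ℕ} {ℓ f : ℕ → ℕ} (h : IsRowLabelling n m ℓ f) :
    IsRowLabelling n m (fun r => ℓ (m - r)) (fun k => m - f (n + 1 - k)) := by
  have hmem : ∀ k ∈ Icc 1 n, n + 1 - k ∈ Icc 1 n := by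
    intro k hk
    rw [mem_Icc] at hk ⊢
    omega
  refine ⟨fun k _ => Nat.sub_le _ _, fun r hr => ?_, fun r hr => ?_⟩
  · rw [← h.card (m - r) (Nat.sub_le _ _)]
    refine card_nbij' (fun k => n + 1 - k) (fun k => n + 1 - k) ?_ ?_ ?_ ?_
    · intro k hk
      simp only [coe_filter, Set.mem_ofPred_eq] at hk ⊢
      have := h.le _ (hmem k hk.1)
      exact ⟨hmem k hk.1, by omega⟩
    · intro k hk
      simp only [coe_filter, Set.mem_ofPred_eq] at hk ⊢
      refine ⟨hmem k hk.1, ?_⟩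
      rw [mem_Icc] at hk
      rw [show n + 1 - (n + 1 - k) = k by omega]
      omega
    · intro k hk
      simp only [coe_filter, Set.mem_ofPred_eq, mem_Icc] at hk
      dsimp only
      omega
    · intro k hk
      simp only [coe_filter, Set.mem_ofPred_eq, mem_Icc] at hk
      dsimp only
      omega
  · obtain ⟨i, hi, j, hj, hij, hfi, hfj⟩ := h.link (m - r - 1) (by omega)
    refine ⟨n + 1 - j, hmem j hj, n + 1 - i, hmem i hi, ?_, ?_, ?_⟩
    · rw [mem_Icc] at hi hj
      omega
    · rw [mem_Icc] at hj
      rw [show n + 1 - (n + 1 - j) = j by omega]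
      omega
    · rw [mem_Icc] at hi
      rw [show n + 1 - (n + 1 - i) = i by omega]
      omega

lemma mem_ascents_rotate {n m k : ℕ} {f : ℕ → ℕ} (hf : ∀ k ∈ Icc 1 n, f k ≤ m) :
    k ∈ ascents n (fun k => m - f (n + 1 - k)) ↔ k ≤ n ∧ n - k ∈ ascents n f := by
  simp only [ascents, mem_filter, mem_Ico]
  by_cases hk : 1 ≤ k ∧ k < n
  · have h1 := hf (n - k) (mem_Icc.2 (by omega))
    have h2 := hf (n - k + 1) (mem_Icc.2 (by omega))
    rw [show n + 1 - k = n - k + 1 by omega, show n + 1 - (k + 1) = n - k by omega]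
    omega
  · omega

/-- Two adjacent rows of different lengths can be exchanged. -/
lemma IsRowLabelling.exists_swap {n m t : ℕ} {ℓ f : ℕ → ℕ} (h : IsRowLabelling n m ℓ f)
    (ht : t < m) (htwo : ∀ r ≤ m, 2 ≤ ℓ r) (hne : ℓ t ≠ ℓ (t + 1)) :
    ∃ f', IsRowLabelling n m (fun r => ℓ (Equiv.swap t (t + 1) r)) f' ∧
      ascents n f' = ascents n f := by
  rcases hne.lt_or_gt with hlt | hgt
  · exact h.exists_swap_of_lt ht htwo hlt
  · obtain ⟨g, hg, hasc⟩ := h.rotate.exists_swap_of_lt (t := m - t - 1) (by omega)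
      (fun r _ => htwo _ (Nat.sub_le _ _))
      (by
        rw [show m - (m - t - 1) = t + 1 by omega, show m - (m - t - 1 + 1) = t by omega]
        exact hgt)
    refine ⟨_, ⟨hg.rotate.le, fun r hr => ?_, hg.rotate.link⟩, ?_⟩
    · rw [hg.rotate.card r hr]
      congr 1
      simp only [Equiv.swap_apply_def]
      split_ifs <;> omega
    · ext k
      rw [mem_ascents_rotate hg.le, hasc, mem_ascents_rotate h.le]
      have : k ∈ ascents n f → k ≤ n := by
        simp only [ascents, mem_filter, mem_Ico]
        omega
      constructor
      · rintro ⟨h1, -, h2⟩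
        rwa [Nat.sub_sub_self h1] at h2
      · intro hk
        exact ⟨this hk, Nat.sub_le _ _, by rwa [Nat.sub_sub_self (this hk)]⟩

lemma SkewShape.mem_cells_iff (A : SkewShape) (i j : ℕ) :
    (i, j) ∈ A.cells ↔ A.mu.rowLen i ≤ j ∧ j < A.lam.rowLen i := by
  rw [SkewShape.cells, mem_sdiff, YoungDiagram.mem_cells, YoungDiagram.mem_cells,
    YoungDiagram.mem_iff_lt_rowLen, YoungDiagram.mem_iff_lt_rowLen, not_lt, and_comm]

lemma SkewShape.rowCols_cells (A : SkewShape) (i : ℕ) :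
    rowCols A.cells i = Ico (A.mu.rowLen i) (A.lam.rowLen i) := by
  ext j
  rw [mem_Ico, ← A.mem_cells_iff]
  simp only [rowCols, mem_image, mem_filter, Prod.exists]
  constructor
  · rintro ⟨a, b, ⟨h, rfl⟩, rfl⟩
    exact h
  · intro h
    exact ⟨i, j, ⟨h, rfl⟩, rfl⟩

lemma card_rowCols (s : Finset (ℕ × ℕ)) (i : ℕ) :
    (rowCols s i).card = (s.filter (fun c => c.1 = i)).card := by
  refine card_image_of_injOn fun c hc d hd hcd => ?_
  simp only [coe_filter, Set.mem_ofPred_eq] at hc hd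
  exact Prod.ext (hc.2.trans hd.2.symm) hcd

lemma IsRibbonOn.mem_rows {s : Finset (ℕ × ℕ)} {r0 r1 : ℕ} (h : IsRibbonOn s r0 r1) {c : ℕ × ℕ}
    (hc : c ∈ s) : r0 ≤ c.1 ∧ c.1 ≤ r1 :=
  (h.2.1 c.1).1 ⟨c.2, mem_image_of_mem _ (mem_filter.2 ⟨hc, rfl⟩)⟩

lemma IsRibbonOn.card_eq_sum {s : Finset (ℕ × ℕ)} {r0 m : ℕ} (h : IsRibbonOn s r0 (r0 + m)) :
    s.card = ∑ r ∈ range (m + 1), (rowCols s (r0 + r)).card := by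
  rw [card_eq_sum_card_fiberwise (f := fun c => c.1 - r0) (t := range (m + 1))]
  · refine sum_congr rfl fun r _ => ?_
    rw [card_rowCols]
    congr 1
    apply filter_congr
    intro c hc
    have := h.mem_rows hc
    omega
  · intro c hc
    have := h.mem_rows hc
    simp only [coe_range, Set.mem_Iio]
    omega

/-- In a ribbon shape, the last column of each row is the first column of the row above. -/
lemma IsRibbonOn.rowLen_succ {A : SkewShape} {r0 r1 i : ℕ} (h : IsRibbonOn A.cells r0 r1)
    (h0 : r0 ≤ i) (h1 : i < r1) : A.lam.rowLen (i + 1) = A.mu.rowLen i + 1 := by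
  have h3 := h.2.2 i h0 h1
  have hl := A.lam.rowLen_anti i (i + 1) (Nat.le_succ i)
  have hm := A.mu.rowLen_anti i (i + 1) (Nat.le_succ i)
  rw [A.rowCols_cells, A.rowCols_cells, Ico_inter_Ico, Nat.card_Ico] at h3
  rw [max_eq_left hm, min_eq_right hl] at h3
  omega

lemma SYT.exists_entry_eq {A : SkewShape} (T : SYT A) {k : ℕ} (hk : k ∈ Icc 1 A.size) :
    ∃ c ∈ A.cells, T.entry c = k := by
  have hsub : A.cells.image T.entry ⊆ Icc 1 A.size := by
    intro x hx
    obtain ⟨c, hc, rfl⟩ := mem_image.1 hx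
    exact T.mem_range c hc
  have := eq_of_subset_of_card_le hsub
    (by rw [card_image_of_injOn T.injOn, Nat.card_Icc, SkewShape.size]; omega)
  rw [← this] at hk
  exact mem_image.1 hk

lemma SYT.descentSet_eq_ascents {A : SkewShape} {r0 r1 : ℕ} (h : IsRibbonOn A.cells r0 r1)
    (T : SYT A) {f : ℕ → ℕ} (hf : ∀ c ∈ A.cells, f (T.entry c) = c.1 - r0) :
    T.descentSet = ascents A.size f := by
  apply filter_congr
  intro k hk
  rw [mem_Ico] at hk
  constructor
  · rintro ⟨c, hc, c', hc', rfl, hk', hlt⟩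
    have h1 := h.mem_rows hc
    rw [← hk', hf c hc, hf c' hc']
    omega
  · intro hlt
    obtain ⟨c, hc, rfl⟩ := T.exists_entry_eq (k := k) (mem_Icc.2 (by omega))
    obtain ⟨c', hc', hk'⟩ := T.exists_entry_eq (k := T.entry c + 1) (mem_Icc.2 (by omega))
    refine ⟨c, hc, c', hc', rfl, hk', ?_⟩
    rw [← hk', hf c hc, hf c' hc'] at hlt
    omega

lemma SYT.exists_isRowLabelling {A : SkewShape} {r0 m : ℕ} (h : IsRibbonOn A.cells r0 (r0 + m))
    (T : SYT A) :
    ∃ f, IsRowLabelling A.size m (fun r => (rowCols A.cells (r0 + r)).card) f ∧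
      T.descentSet = ascents A.size f := by
  set f : ℕ → ℕ := fun k => (Function.invFunOn T.entry (A.cells : Set (ℕ × ℕ)) k).1 - r0
  have hf : ∀ c ∈ A.cells, f (T.entry c) = c.1 - r0 := by
    intro c hc
    simp only [f]
    rw [T.injOn.leftInvOn_invFunOn (mem_coe.2 hc)]
  refine ⟨f, ⟨fun k hk => ?_, fun r hr => ?_, fun r hr => ?_⟩, T.descentSet_eq_ascents h hf⟩
  · obtain ⟨c, hc, rfl⟩ := T.exists_entry_eq hk
    have := h.mem_rows hc
    rw [hf c hc]
    omega
  · rw [card_rowCols]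
    symm
    refine card_bij (fun c _ => T.entry c) ?_ ?_ ?_
    · intro c hc
      rw [mem_filter] at hc ⊢
      exact ⟨T.mem_range c hc.1, by rw [hf c hc.1]; omega⟩
    · intro c hc d hd hcd
      exact T.injOn (mem_of_mem_filter c hc) (mem_of_mem_filter d hd) hcd
    · intro k hk
      rw [mem_filter] at hk
      obtain ⟨c, hc, rfl⟩ := T.exists_entry_eq hk.1
      rw [hf c hc] at hk
      have := h.mem_rows hc
      exact ⟨c, mem_filter.2 ⟨hc, by omega⟩, rfl⟩
  · have hrow := h.rowLen_succ (i := r0 + r) (by omega) (by omega)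
    have hne := (h.2.1 (r0 + r)).2 (by omega)
    have hne' := (h.2.1 (r0 + r + 1)).2 (by omega)
    rw [A.rowCols_cells, nonempty_Ico] at hne hne'
    have hc : (r0 + r, A.mu.rowLen (r0 + r)) ∈ A.cells := (A.mem_cells_iff _ _).2 (by omega)
    have hc' : (r0 + r + 1, A.mu.rowLen (r0 + r)) ∈ A.cells := (A.mem_cells_iff _ _).2 (by omega)
    refine ⟨_, T.mem_range _ hc, _, T.mem_range _ hc', T.col_lt _ _ _ hc hc' (by omega), ?_, ?_⟩
    · rw [hf _ hc]
      dsimp only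
      omega
    · rw [hf _ hc']
      dsimp only
      omega

lemma exists_enumeration (S : Finset ℕ) : ∃ e : ℕ → ℕ, (∀ s < S.card, e s ∈ S) ∧
    (∀ s s', s < s' → s' < S.card → e s < e s') ∧ ∀ x ∈ S, ∃ s < S.card, e s = x := by
  refine ⟨fun s => if hs : s < S.card then S.orderEmbOfFin rfl ⟨s, hs⟩ else 0, ?_, ?_, ?_⟩
  · intro s hs
    simp only [dif_pos hs]
    exact S.orderEmbOfFin_mem rfl _
  · intro s s' hs hs'
    simp only [dif_pos hs', dif_pos (hs.trans hs')]
    exact (S.orderEmbOfFin rfl).strictMono hs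
  · intro x hx
    rw [← mem_coe, ← S.range_orderEmbOfFin rfl] at hx
    obtain ⟨s, rfl⟩ := hx
    exact ⟨s, s.2, by simp⟩

lemma IsRowLabelling.exists_SYT {A : SkewShape} {r0 m : ℕ} {f : ℕ → ℕ}
    (hA : IsRibbonOn A.cells r0 (r0 + m)) (htwo : ∀ r ≤ m, 2 ≤ (rowCols A.cells (r0 + r)).card)
    (h : IsRowLabelling A.size m (fun r => (rowCols A.cells (r0 + r)).card) f) :
    ∃ T : SYT A, T.descentSet = ascents A.size f := by
  classical
  choose e hmem hlt hsurj using fun r =>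
    exists_enumeration ((Icc 1 A.size).filter (fun k => f k = r))
  have hrow : ∀ i j, (i, j) ∈ A.cells → r0 ≤ i ∧ i ≤ r0 + m ∧ A.mu.rowLen i ≤ j ∧
      j - A.mu.rowLen i < ((Icc 1 A.size).filter (fun k => f k = i - r0)).card := by
    intro i j hc
    have h1 := hA.mem_rows hc
    dsimp only at h1
    have h2 := (A.mem_cells_iff i j).1 hc
    rw [h.card (i - r0) (by omega), show r0 + (i - r0) = i by omega, A.rowCols_cells,
      Nat.card_Ico]
    omega
  set E : ℕ × ℕ → ℕ := fun c => if c ∈ A.cells then e (c.1 - r0) (c.2 - A.mu.rowLen c.1) else 0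
    with hE
  have hEc : ∀ i j, (i, j) ∈ A.cells → E (i, j) = e (i - r0) (j - A.mu.rowLen i) := by
    intro i j hc
    simp only [hE, if_pos hc]
  have hEmem : ∀ i j, (i, j) ∈ A.cells → E (i, j) ∈ Icc 1 A.size ∧ f (E (i, j)) = i - r0 := by
    intro i j hc
    rw [hEc i j hc]
    exact mem_filter.1 (hmem _ _ (hrow i j hc).2.2.2)
  have hErow : ∀ i j j', (i, j) ∈ A.cells → (i, j') ∈ A.cells → j < j' → E (i, j) < E (i, j') := by
    intro i j j' hc hc' hjj
    rw [hEc _ _ hc, hEc _ _ hc']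
    have h1 := hrow i j hc
    exact hlt _ _ _ (by omega) (hrow i j' hc').2.2.2
  let T : SYT A :=
    { entry := E
      zero_off := fun c hc => if_neg hc
      mem_range := fun c hc => (hEmem c.1 c.2 hc).1
      injOn := by
        rintro ⟨i, j⟩ hc ⟨i', j'⟩ hc' heq
        rw [mem_coe] at hc hc'
        have h1 := (hEmem i j hc).2
        have h2 := (hEmem i' j' hc').2
        have h3 := hrow i j hc
        have h4 := hrow i' j' hc'
        rw [heq, h2] at h1
        obtain rfl : i = i' := by omega
        rcases lt_trichotomy j j' with hj | rfl | hj
        · exact absurd heq (hErow i j j' hc hc' hj).ne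
        · rfl
        · exact absurd heq (hErow i j' j hc' hc hj).ne'
      row_lt := hErow
      col_lt := by
        intro i i' j hc hc' hii
        have h1 := hrow i j hc
        have h2 := hrow i' j hc'
        have h3 := (A.mem_cells_iff i j).1 hc
        have h4 := (A.mem_cells_iff i' j).1 hc'
        have hstep := hA.rowLen_succ (i := i) (by omega) (by omega)
        have hnext := htwo (i + 1 - r0) (by omega)
        rw [show r0 + (i + 1 - r0) = i + 1 by omega, A.rowCols_cells, Nat.card_Ico] at hnext
        have hi' : i' = i + 1 := by
          by_contra hne
          have hstep' := hA.rowLen_succ (i := i + 1) (by omega) (by omega)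
          have := A.lam.rowLen_anti (i + 1 + 1) i' (by omega)
          omega
        subst hi'
        obtain ⟨x, hx, y, hy, hxy, hfx, hfy⟩ := h.link (i - r0) (by omega)
        obtain ⟨s, hs, rfl⟩ := hsurj (i - r0) x (mem_filter.2 ⟨hx, hfx⟩)
        obtain ⟨s', hs', rfl⟩ := hsurj (i + 1 - r0) y (mem_filter.2 ⟨hy, by omega⟩)
        rw [hEc _ _ hc, hEc _ _ hc']
        have hle : e (i - r0) (j - A.mu.rowLen i) ≤ e (i - r0) s := by
          rcases (Nat.zero_le s).eq_or_lt with h0 | h0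
          · rw [show j - A.mu.rowLen i = s by omega]
          · exact (hlt _ _ _ (by omega) hs).le
        have hle' : e (i + 1 - r0) s' ≤ e (i + 1 - r0) (j - A.mu.rowLen (i + 1)) := by
          have hs2 := hs'
          rw [h.card (i + 1 - r0) (by omega), show r0 + (i + 1 - r0) = i + 1 by omega,
            A.rowCols_cells, Nat.card_Ico] at hs2
          rcases (show s' ≤ j - A.mu.rowLen (i + 1) by omega).eq_or_lt with h0 | h0
          · rw [h0]
          · exact (hlt _ _ _ h0 h2.2.2.2).le
        omega }
  exact ⟨T, T.descentSet_eq_ascents hA fun c hc => (hEmem c.1 c.2 hc).2⟩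

lemma mem_Fsupp_iff {A : SkewShape} {r0 m : ℕ} (hA : IsRibbonOn A.cells r0 (r0 + m))
    (htwo : ∀ r ≤ m, 2 ≤ (rowCols A.cells (r0 + r)).card) (α : List ℕ) :
    α ∈ Fsupp A ↔ ∃ f, IsRowLabelling A.size m (fun r => (rowCols A.cells (r0 + r)).card) f ∧
      compOfSet A.size (ascents A.size f) = α := by
  constructor
  · rintro ⟨T, rfl⟩
    obtain ⟨f, hf, hT⟩ := T.exists_isRowLabelling hA
    exact ⟨f, hf, by rw [SYT.descentComp, hT]⟩
  · rintro ⟨f, hf, rfl⟩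
    obtain ⟨T, hT⟩ := hf.exists_SYT hA htwo
    exact ⟨T, by rw [SYT.descentComp, hT]⟩

lemma IsRowLabelling.congr {n m : ℕ} {ℓ ℓ' f : ℕ → ℕ} (h : IsRowLabelling n m ℓ f)
    (hℓ : ∀ r ≤ m, ℓ r = ℓ' r) : IsRowLabelling n m ℓ' f :=
  ⟨h.le, fun r hr => (h.card r hr).trans (hℓ r hr), h.link⟩

theorem stmt13 (A A' : SkewShape) (r0 r1 r0' : ℕ)
    (hA : IsRibbonOn A.cells r0 r1)
    (hA' : IsRibbonOn A'.cells r0' (r0' + (r1 - r0)))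
    (helong : ∀ i, r0 ≤ i → i ≤ r1 → 2 ≤ (rowCols A.cells i).card)
    (t : ℕ) (ht : r0 + t < r1)
    (hlonger : (rowCols A.cells (r0 + t)).card < (rowCols A.cells (r0 + t + 1)).card)
    (hswap : ∀ u, u ≤ r1 - r0 →
      (rowCols A'.cells (r0' + u)).card = (rowCols A.cells (r0 + (Equiv.swap t (t + 1) u))).card) :
    Fsupp A = Fsupp A' := by
  obtain ⟨m, rfl⟩ := Nat.exists_eq_add_of_le hA.1
  rw [Nat.add_sub_cancel_left] at hA' hswap
  replace ht : t < m := by omega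
  have hle : ∀ u ≤ m, Equiv.swap t (t + 1) u ≤ m := by
    intro u hu
    rw [Equiv.swap_apply_def]
    split_ifs <;> omega
  have htwo : ∀ r ≤ m, 2 ≤ (rowCols A.cells (r0 + r)).card := fun r hr =>
    helong _ (by omega) (by omega)
  have htwo' : ∀ r ≤ m, 2 ≤ (rowCols A'.cells (r0' + r)).card := fun r hr => by
    rw [hswap r hr]
    exact htwo _ (hle r hr)
  have hsize : A'.size = A.size := by
    rw [SkewShape.size, SkewShape.size, hA.card_eq_sum, hA'.card_eq_sum,
      sum_congr rfl fun r hr => hswap r (by rw [mem_range] at hr; omega)]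
    refine sum_nbij' (Equiv.swap t (t + 1)) (Equiv.swap t (t + 1)) ?_ ?_ ?_ ?_ ?_
    · intro r hr
      rw [mem_range] at hr ⊢
      have := hle r (by omega)
      omega
    · intro r hr
      rw [mem_range] at hr ⊢
      have := hle r (by omega)
      omega
    · simp
    · simp
    · simp
  ext α
  rw [mem_Fsupp_iff hA htwo, mem_Fsupp_iff hA' htwo', hsize]
  constructor
  · rintro ⟨f, hf, rfl⟩
    obtain ⟨g, hg, hasc⟩ := hf.exists_swap ht htwo hlonger.ne
    exact ⟨g, hg.congr fun r hr => (hswap r hr).symm, by rw [hasc]⟩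
  · rintro ⟨f, hf, rfl⟩
    have hne : (rowCols A'.cells (r0' + t)).card ≠ (rowCols A'.cells (r0' + (t + 1))).card := by
      rw [hswap t ht.le, hswap (t + 1) ht, Equiv.swap_apply_left, Equiv.swap_apply_right]
      exact hlonger.ne'
    obtain ⟨g, hg, hasc⟩ := hf.exists_swap ht htwo' hne
    refine ⟨g, hg.congr fun r hr => ?_, by rw [hasc]⟩
    rw [hswap _ (hle r hr), Equiv.swap_apply_self]

end SkewPaper
end

section
/- Let n ≥ 2 and 1 ≤ ℓ ≤ n−1. Let A be the skew shape (n−ℓ+1, 1^ℓ)/(1), i.e., the disconnected shape (1^ℓ) ⊕ (n−ℓ) consisting of a column of ℓ boxes placed strictly below and to the left of a row of n−ℓ boxes, and let B be the hook (n−ℓ, 1^ℓ) or the hook (n−ℓ+1, 1^{ℓ−1}). Then s_A − s_B is F-positive: for every composition α of n, the number of standard Young tableaux of shape B with descent composition α is at most the number of standard Young tableaux of shape A with descent composition α. -/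
namespace SkewPaper

open Finset

theorem SYT.ext_entry {A : SkewShape} {T T' : SYT A} (h : T.entry = T'.entry) : T = T' := by
  cases T
  cases T'
  simpa using h

instance finite_SYT (A : SkewShape) : Finite (SYT A) := by
  refine Finite.of_injective
    (fun (T : SYT A) (c : A.cells) => (⟨T.entry c, by
      have := T.mem_range c c.2
      simp only [Finset.mem_Icc] at this
      omega⟩ : Fin (A.size + 1))) ?_
  intro T T' h
  refine SYT.ext_entry (funext fun c => ?_)
  by_cases hc : c ∈ A.cells
  · simpa using congrFun h ⟨c, hc⟩
  · rw [T.zero_off c hc, T'.zero_off c hc]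

theorem size_eq_of_bijOn {A B : SkewShape} {f : ℕ × ℕ → ℕ × ℕ}
    (hf : Set.BijOn f ↑A.cells ↑B.cells) : A.size = B.size :=
  Finset.card_nbij f (fun _ hc => hf.mapsTo hc) hf.injOn hf.surjOn

/-- The pullback of a standard Young tableau along a bijection of cells that sends rows into
rows and columns into columns, preserving the order within each. -/
def SYT.pullback {A B : SkewShape} (T : SYT B) (f : ℕ × ℕ → ℕ × ℕ)
    (hf : Set.BijOn f ↑A.cells ↑B.cells)
    (hrow : ∀ i j j', (i, j) ∈ A.cells → (i, j') ∈ A.cells → j < j' →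
      (f (i, j)).1 = (f (i, j')).1 ∧ (f (i, j)).2 < (f (i, j')).2)
    (hcol : ∀ i i' j, (i, j) ∈ A.cells → (i', j) ∈ A.cells → i < i' →
      (f (i, j)).1 < (f (i', j)).1 ∧ (f (i, j)).2 = (f (i', j)).2) : SYT A where
  entry c := if c ∈ A.cells then T.entry (f c) else 0
  zero_off c hc := if_neg hc
  mem_range c hc := by
    rw [if_pos hc, size_eq_of_bijOn hf]
    exact T.mem_range _ (hf.mapsTo hc)
  injOn c hc c' hc' h := by
    rw [Finset.mem_coe] at hc hc'
    simp only [if_pos hc, if_pos hc'] at h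
    exact hf.injOn hc hc' (T.injOn (hf.mapsTo hc) (hf.mapsTo hc') h)
  row_lt i j j' hc hc' h := by
    rw [if_pos hc, if_pos hc']
    obtain ⟨h1, h2⟩ := hrow i j j' hc hc' h
    have m : f (i, j) ∈ B.cells := hf.mapsTo hc
    have m' : f (i, j') ∈ B.cells := hf.mapsTo hc'
    generalize f (i, j) = p at *
    generalize f (i, j') = q at *
    obtain ⟨a, b⟩ := p
    obtain ⟨a', b'⟩ := q
    obtain rfl : a = a' := h1
    exact T.row_lt _ _ _ m m' h2
  col_lt i i' j hc hc' h := by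
    rw [if_pos hc, if_pos hc']
    obtain ⟨h1, h2⟩ := hcol i i' j hc hc' h
    have m : f (i, j) ∈ B.cells := hf.mapsTo hc
    have m' : f (i', j) ∈ B.cells := hf.mapsTo hc'
    generalize f (i, j) = p at *
    generalize f (i', j) = q at *
    obtain ⟨a, b⟩ := p
    obtain ⟨a', b'⟩ := q
    obtain rfl : b = b' := h2
    exact T.col_lt _ _ _ m m' h1

theorem countSYT_le_of_pullback {A B : SkewShape} (f : ℕ × ℕ → ℕ × ℕ)
    (hf : Set.BijOn f ↑A.cells ↑B.cells)
    (hrow : ∀ i j j', (i, j) ∈ A.cells → (i, j') ∈ A.cells → j < j' →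
      (f (i, j)).1 = (f (i, j')).1 ∧ (f (i, j)).2 < (f (i, j')).2)
    (hcol : ∀ i i' j, (i, j) ∈ A.cells → (i', j) ∈ A.cells → i < i' →
      (f (i, j)).1 < (f (i', j)).1 ∧ (f (i, j)).2 = (f (i', j)).2)
    (hdesc : ∀ T : SYT B, ∀ c ∈ A.cells, ∀ c' ∈ A.cells, T.entry (f c) < T.entry (f c') →
      ((f c).1 < (f c').1 ↔ c.1 < c'.1)) (α : List ℕ) :
    countSYT B α ≤ countSYT A α := by
  have hset : ∀ T : SYT B, (T.pullback f hf hrow hcol).descentSet = T.descentSet := by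
    intro T
    ext k
    simp only [SYT.descentSet, Finset.mem_filter, size_eq_of_bijOn hf]
    refine and_congr_right fun _ => ⟨?_, ?_⟩
    · rintro ⟨c, hc, c', hc', h, h', hlt⟩
      simp only [SYT.pullback, if_pos hc, if_pos hc'] at h h'
      exact ⟨f c, hf.mapsTo hc, f c', hf.mapsTo hc', h, h',
        (hdesc T c hc c' hc' (by omega)).2 hlt⟩
    · rintro ⟨d, hd, d', hd', h, h', hlt⟩
      obtain ⟨c, hc, rfl⟩ := hf.surjOn hd
      obtain ⟨c', hc', rfl⟩ := hf.surjOn hd'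
      rw [Finset.mem_coe] at hc hc'
      refine ⟨c, hc, c', hc', ?_, ?_, (hdesc T c hc c' hc' (by omega)).1 hlt⟩
      · simpa only [SYT.pullback, if_pos hc] using h
      · simpa only [SYT.pullback, if_pos hc'] using h'
  refine Nat.card_le_card_of_injective
    (fun T : {T : SYT B // T.descentComp = α} =>
      (⟨T.1.pullback f hf hrow hcol, by
        rw [SYT.descentComp, hset, size_eq_of_bijOn hf]
        exact T.2⟩ : {T : SYT A // T.descentComp = α})) ?_
  rintro ⟨T, _⟩ ⟨T', _⟩ h
  have hentry := congrArg (fun S => S.1.entry) h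
  refine Subtype.ext (SYT.ext_entry (funext fun d => ?_))
  by_cases hd : d ∈ B.cells
  · obtain ⟨c, hc, rfl⟩ := hf.surjOn hd
    rw [Finset.mem_coe] at hc
    simpa only [SYT.pullback, if_pos hc] using congrFun hentry c
  · exact (T.zero_off d hd).trans (T'.zero_off d hd).symm

theorem mem_hookCells {m l : ℕ} {c : ℕ × ℕ} :
    c ∈ hookCells m l ↔ (c.1 = 0 ∧ c.2 < m) ∨ (1 ≤ c.1 ∧ c.1 ≤ l ∧ c.2 = 0) := by
  obtain ⟨a, b⟩ := c
  simp only [hookCells, Finset.mem_union, Finset.mem_image, Finset.mem_range, Finset.mem_Icc,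
    Prod.mk.injEq]
  grind

theorem SYT.entry_corner_le {B : SkewShape} (T : SYT B) {m l : ℕ}
    (hB : B.cells = hookCells m l) (hm : 0 < m) {c : ℕ × ℕ} (hc : c ∈ B.cells) :
    T.entry (0, 0) ≤ T.entry c := by
  have h0 : (0, 0) ∈ B.cells := by simp [hB, mem_hookCells, hm]
  obtain ⟨a, b⟩ := c
  have hc' := hc
  simp only [hB, mem_hookCells] at hc'
  rcases hc' with ⟨rfl, -⟩ | ⟨ha, -, rfl⟩
  · rcases Nat.eq_zero_or_pos b with rfl | hb
    · exact le_rfl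
    · exact (T.row_lt _ _ _ h0 hc hb).le
  · exact (T.col_lt _ _ _ h0 hc ha).le

theorem stmt16 (n l : ℕ) (hn : 2 ≤ n) (hl1 : 1 ≤ l) (hl2 : l ≤ n - 1)
    (A B : SkewShape)
    (hA : A.cells = ((Finset.Icc 1 (n - l)).image (fun j => ((0 : ℕ), j))) ∪
      ((Finset.Icc 1 l).image (fun i => (i, (0 : ℕ)))))
    (hB : B.cells = hookCells (n - l) l ∨ B.cells = hookCells (n - l + 1) (l - 1)) :
    ∀ α : List ℕ, countSYT B α ≤ countSYT A α := by
  have memA : ∀ c : ℕ × ℕ, c ∈ A.cells ↔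
      (c.1 = 0 ∧ 1 ≤ c.2 ∧ c.2 ≤ n - l) ∨ (1 ≤ c.1 ∧ c.1 ≤ l ∧ c.2 = 0) := by
    rintro ⟨a, b⟩
    simp only [hA, Finset.mem_union, Finset.mem_image, Finset.mem_Icc, Prod.mk.injEq]
    grind
  rcases hB with hB | hB
  · have memB : ∀ c : ℕ × ℕ, c ∈ B.cells ↔ _ := fun c => by rw [hB, mem_hookCells]
    refine countSYT_le_of_pullback (fun c => if c.1 = 0 then (0, c.2 - 1) else c)
      ⟨?_, ?_, ?_⟩ ?_ ?_ ?_
    · intro c hc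
      simp only [Finset.mem_coe, memA, memB] at hc ⊢
      grind
    · intro c hc c' hc' h
      simp only [Finset.mem_coe, memA] at hc hc' h
      grind
    · rintro ⟨a, b⟩ hd
      simp only [Finset.mem_coe, memB] at hd
      refine ⟨if a = 0 then (0, b + 1) else (a, b), ?_, ?_⟩
      · simp only [Finset.mem_coe, memA]
        grind
      · grind
    · intro i j j' hc hc' h
      simp only [memA] at hc hc'
      grind
    · intro i i' j hc hc' h
      simp only [memA] at hc hc'
      grind
    · intro T c hc c' hc' _
      grind
  · have memB : ∀ c : ℕ × ℕ, c ∈ B.cells ↔ _ := fun c => by rw [hB, mem_hookCells]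
    have hf : Set.BijOn (fun c : ℕ × ℕ => if c.1 = 0 then c else (c.1 - 1, 0))
        ↑A.cells ↑B.cells := by
      refine ⟨?_, ?_, ?_⟩
      · intro c hc
        simp only [Finset.mem_coe, memA, memB] at hc ⊢
        grind
      · intro c hc c' hc' h
        simp only [Finset.mem_coe, memA] at hc hc' h
        grind
      · rintro ⟨a, b⟩ hd
        simp only [Finset.mem_coe, memB] at hd
        refine ⟨if b = 0 then (a + 1, 0) else (a, b), ?_, ?_⟩
        · simp only [Finset.mem_coe, memA]
          grind
        · grind
    refine countSYT_le_of_pullback _ hf ?_ ?_ ?_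
    · intro i j j' hc hc' h
      simp only [memA] at hc hc'
      grind
    · intro i i' j hc hc' h
      simp only [memA] at hc hc'
      grind
    · intro T c hc c' hc' hlt
      have hmin := T.entry_corner_le hB (Nat.succ_pos _) (hf.mapsTo hc)
      have hne : c' ≠ (1, 0) := by
        rintro rfl
        exact absurd hlt (not_lt.mpr hmin)
      simp only [memA] at hc hc'
      obtain ⟨a, b⟩ := c
      obtain ⟨a', b'⟩ := c'
      simp only [ne_eq, Prod.mk.injEq] at hc hc' hne ⊢
      split_ifs <;> simp only <;> omega

end SkewPaper
end

section
/- Let n ≥ 4. Let A be the skew shape (3, 1^{n−2})/(1), i.e., the disconnected shape (1^{n−2}) ⊕ (2), and let B be the straight shape (2, 2, 1^{n−4}). Then s_A − s_B is F-positive: for every composition α of n, the number of standard Young tableaux of shape B with descent composition α is at most the number of standard Young tableaux of shape A with descent composition α. -/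
namespace SkewPaper

open Finset

namespace SYT

theorem entry_injective {A : SkewShape} : Function.Injective (SYT.entry (A := A)) := by
  rintro ⟨e, _, _, _, _, _⟩ ⟨e', _, _, _, _, _⟩ h
  cases h
  rfl

instance instFinite (A : SkewShape) : Finite (SYT A) := by
  refine Finite.of_injective
    (fun T (c : A.cells) => (⟨T.entry c, T.mem_range c c.2⟩ : Finset.Icc 1 A.size)) ?_
  intro T T' h
  apply entry_injective
  funext c
  by_cases hc : c ∈ A.cells
  · exact congrArg Subtype.val (congrFun h ⟨c, hc⟩)
  · rw [T.zero_off c hc, T'.zero_off c hc]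

theorem exists_entry_eq_s18 {A : SkewShape} (T : SYT A) {k : ℕ} (h1 : 1 ≤ k) (h2 : k ≤ A.size) :
    ∃ c ∈ A.cells, T.entry c = k := by
  have h : A.cells.image T.entry = Finset.Icc 1 A.size := by
    apply Finset.eq_of_subset_of_card_le
    · exact Finset.image_subset_iff.2 T.mem_range
    · rw [Finset.card_image_of_injOn T.injOn, Nat.card_Icc, SkewShape.size]
      omega
  have hk : k ∈ A.cells.image T.entry := by
    rw [h]
    exact Finset.mem_Icc.2 ⟨h1, h2⟩
  simpa using hk

end SYT

/-- If every tableau of shape `B` can be matched injectively with a tableau of shape `A` of the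
same size and descent set, then `s_A - s_B` is F-positive. -/
theorem countSYT_le_of_injective {A B : SkewShape} (hs : B.size = A.size) (f : SYT B → SYT A)
    (hf : Function.Injective f) (hd : ∀ T, (f T).descentSet = T.descentSet) (α : List ℕ) :
    countSYT B α ≤ countSYT A α := by
  refine Nat.card_le_card_of_injective
    (fun T => ⟨f T.1, by rw [SYT.descentComp, hd, ← hs]; exact T.2⟩) ?_
  intro T T' h
  exact Subtype.ext (hf (congrArg Subtype.val h))

/-- The cells of the disconnected shape `(1^(n-2)) ⊕ (2)`. -/
def IsColumnPlusRow (n : ℕ) (A : SkewShape) : Prop :=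
  ∀ i j, (i, j) ∈ A.cells ↔ (i = 0 ∧ j = 1) ∨ (i = 0 ∧ j = 2) ∨ (1 ≤ i ∧ i ≤ n - 2 ∧ j = 0)

/-- The cells of the straight shape `(2, 2, 1^(n-4))`. -/
def IsTwoColumn (n : ℕ) (B : SkewShape) : Prop :=
  ∀ i j, (i, j) ∈ B.cells ↔ (i ≤ n - 3 ∧ j = 0) ∨ (i ≤ 1 ∧ j = 1)

/-- The filling of `(1^(n-2)) ⊕ (2)` with row entries `a < b` and the other numbers in the
column. -/
def pairEntry (n a b : ℕ) (c : ℕ × ℕ) : ℕ :=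
  if c.2 = 0 ∧ 1 ≤ c.1 ∧ c.1 ≤ n - 2 then
    (if c.1 < a then c.1 else if c.1 + 1 < b then c.1 + 1 else c.1 + 2)
  else if c.1 = 0 ∧ c.2 = 1 then a else if c.1 = 0 ∧ c.2 = 2 then b else 0

section pairEntry

variable {n a b : ℕ}

theorem pairEntry_col {i : ℕ} (h1 : 1 ≤ i) (h2 : i ≤ n - 2) :
    pairEntry n a b (i, 0) = if i < a then i else if i + 1 < b then i + 1 else i + 2 := by
  simp [pairEntry, h1, h2]

@[simp] theorem pairEntry_fst : pairEntry n a b (0, 1) = a := by simp [pairEntry]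

@[simp] theorem pairEntry_snd : pairEntry n a b (0, 2) = b := by simp [pairEntry]

end pairEntry

/-- The tableau of shape `(1^(n-2)) ⊕ (2)` with row entries `a < b`. -/
def pairSYT {n : ℕ} {A : SkewShape} (hA : IsColumnPlusRow n A) (hs : A.size = n) {a b : ℕ}
    (ha : 1 ≤ a) (hab : a < b) (hb : b ≤ n) : SYT A where
  entry := pairEntry n a b
  zero_off := by
    rintro ⟨i, j⟩ h
    rw [hA] at h
    simp only [pairEntry]
    split_ifs <;> omega
  mem_range := by
    rintro ⟨i, j⟩ h
    rw [hA] at h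
    simp only [pairEntry, Finset.mem_Icc, hs]
    split_ifs <;> omega
  injOn := by
    rintro ⟨i, j⟩ h ⟨i', j'⟩ h' he
    rw [Finset.mem_coe, hA] at h h'
    rw [Prod.mk.injEq]
    rcases h with ⟨rfl, rfl⟩ | ⟨rfl, rfl⟩ | ⟨h1, h2, rfl⟩ <;>
      rcases h' with ⟨rfl, rfl⟩ | ⟨rfl, rfl⟩ | ⟨h1', h2', rfl⟩ <;>
      simp only [pairEntry_fst, pairEntry_snd, pairEntry_col, *] at he <;>
      (try split_ifs at he) <;> omega
  row_lt := by
    intro i j j' h h' hj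
    rw [hA] at h h'
    obtain ⟨rfl, rfl, rfl⟩ : i = 0 ∧ j = 1 ∧ j' = 2 := by omega
    simpa using hab
  col_lt := by
    intro i i' j h h' hi
    rw [hA] at h h'
    obtain rfl : j = 0 := by omega
    rw [pairEntry_col (by omega) (by omega), pairEntry_col (by omega) (by omega)]
    split_ifs <;> omega

theorem mem_descentSet_pairSYT {n : ℕ} {A : SkewShape} (hA : IsColumnPlusRow n A)
    (hs : A.size = n) {a b : ℕ} (ha : 1 ≤ a) (hab : a < b) (hb : b ≤ n) (k : ℕ) :
    k ∈ (pairSYT hA hs ha hab hb).descentSet ↔ (1 ≤ k ∧ k < n) ∧ k + 1 ≠ a ∧ k + 1 ≠ b := by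
  simp only [SYT.descentSet, Finset.mem_filter, Finset.mem_Ico, hs]
  refine and_congr_right fun hk => ⟨?_, ?_⟩
  · rintro ⟨c, -, ⟨i', j'⟩, h', -, he, hlt⟩
    obtain ⟨h1, h2, rfl⟩ : 1 ≤ i' ∧ i' ≤ n - 2 ∧ j' = 0 := by
      have := (hA _ _).1 h'
      dsimp only at hlt
      omega
    change pairEntry n a b (i', 0) = k + 1 at he
    rw [pairEntry_col h1 h2] at he
    split_ifs at he <;> omega
  · rintro ⟨hka, hkb⟩
    have key : ∀ m, 1 ≤ m → m ≤ n → m ≠ a → m ≠ b → ∃ i, 1 ≤ i ∧ i ≤ n - 2 ∧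
        pairEntry n a b (i, 0) = m := by
      intro m h1 h2 h3 h4
      have hi : ∃ i, 1 ≤ i ∧ i ≤ n - 2 ∧ (m < a ∧ i = m ∨ a < m ∧ m < b ∧ i + 1 = m ∨
          b < m ∧ i + 2 = m) := by
        by_cases hma : m < a
        · exact ⟨m, by omega⟩
        · by_cases hmb : m < b
          · exact ⟨m - 1, by omega⟩
          · exact ⟨m - 2, by omega⟩
      obtain ⟨i, hi1, hi2, hi3⟩ := hi
      refine ⟨i, hi1, hi2, ?_⟩
      rw [pairEntry_col hi1 hi2]
      split_ifs <;> omega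
    obtain ⟨i', h1', h2', he'⟩ := key (k + 1) (by omega) (by omega) hka hkb
    by_cases h3 : k = a
    · exact ⟨(0, 1), (hA _ _).2 (by omega), (i', 0), (hA _ _).2 (by omega),
        (pairEntry_fst (n := n) (b := b)).trans h3.symm, he', h1'⟩
    by_cases h4 : k = b
    · exact ⟨(0, 2), (hA _ _).2 (by omega), (i', 0), (hA _ _).2 (by omega),
        (pairEntry_snd (n := n) (a := a)).trans h4.symm, he', h1'⟩
    obtain ⟨i, h1, h2, he⟩ := key k hk.1 hk.2.le h3 h4
    refine ⟨(i, 0), (hA _ _).2 (by omega), (i', 0), (hA _ _).2 (by omega), he, he', ?_⟩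
    rw [pairEntry_col h1 h2] at he
    rw [pairEntry_col h1' h2'] at he'
    dsimp only
    split_ifs at he he' <;> omega

namespace IsTwoColumn

variable {n : ℕ} {B : SkewShape}

theorem entry_basic (hB : IsTwoColumn n B) (hn : 4 ≤ n) (hs : B.size = n) (T : SYT B) :
    1 ≤ T.entry (0, 0) ∧ T.entry (0, 0) < T.entry (0, 1) ∧ T.entry (0, 0) < T.entry (1, 0) ∧
      T.entry (0, 1) < T.entry (1, 1) ∧ T.entry (1, 0) < T.entry (1, 1) ∧
      T.entry (1, 1) ≤ n := by
  have h00 : (0, 0) ∈ B.cells := (hB _ _).2 (by omega)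
  have h01 : (0, 1) ∈ B.cells := (hB _ _).2 (by omega)
  have h10 : (1, 0) ∈ B.cells := (hB _ _).2 (by omega)
  have h11 : (1, 1) ∈ B.cells := (hB _ _).2 (by omega)
  exact ⟨(Finset.mem_Icc.1 (T.mem_range _ h00)).1, T.row_lt _ _ _ h00 h01 one_pos,
    T.col_lt _ _ _ h00 h10 one_pos, T.col_lt _ _ _ h01 h11 one_pos,
    T.row_lt _ _ _ h10 h11 one_pos, hs ▸ (Finset.mem_Icc.1 (T.mem_range _ h11)).2⟩

theorem col_strictMono (hB : IsTwoColumn n B) (hn : 4 ≤ n) (T : SYT B) :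
    StrictMono fun i : Fin (n - 2) => T.entry (i, 0) := fun i j hij =>
  T.col_lt _ _ _ ((hB _ _).2 (by omega)) ((hB _ _).2 (by omega)) hij

theorem range_col (hB : IsTwoColumn n B) (hn : 4 ≤ n) (hs : B.size = n) (T : SYT B) :
    Set.range (fun i : Fin (n - 2) => T.entry (i, 0)) =
      {k | (1 ≤ k ∧ k ≤ n) ∧ k ≠ T.entry (0, 1) ∧ k ≠ T.entry (1, 1)} := by
  ext k
  constructor
  · rintro ⟨i, rfl⟩
    have hi : ((i : ℕ), 0) ∈ B.cells := (hB _ _).2 (by omega)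
    have hr := Finset.mem_Icc.1 (T.mem_range _ hi)
    rw [hs] at hr
    refine ⟨hr, fun h => ?_, fun h => ?_⟩
    · simpa using T.injOn hi ((hB 0 1).2 (by omega)) h
    · simpa using T.injOn hi ((hB 1 1).2 (by omega)) h
  · rintro ⟨⟨h1, h2⟩, hx, hy⟩
    obtain ⟨⟨i, j⟩, hc, rfl⟩ := T.exists_entry_eq_s18 h1 (hs ▸ h2)
    rcases (hB _ _).1 hc with ⟨hi, rfl⟩ | ⟨hi, rfl⟩
    · exact ⟨⟨i, by omega⟩, rfl⟩
    · obtain rfl | rfl : i = 0 ∨ i = 1 := by omega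
      · exact absurd rfl hx
      · exact absurd rfl hy

theorem eq_of_second_col_eq (hB : IsTwoColumn n B) (hn : 4 ≤ n) (hs : B.size = n) {T T' : SYT B}
    (hx : T.entry (0, 1) = T'.entry (0, 1)) (hy : T.entry (1, 1) = T'.entry (1, 1)) : T = T' := by
  have hcol := (StrictMono.range_inj (hB.col_strictMono hn T) (hB.col_strictMono hn T')).1
    (by rw [hB.range_col hn hs, hB.range_col hn hs, hx, hy])
  apply SYT.entry_injective
  funext ⟨i, j⟩
  by_cases hc : (i, j) ∈ B.cells
  · rcases (hB _ _).1 hc with ⟨hi, rfl⟩ | ⟨hi, rfl⟩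
    · exact congrFun hcol ⟨i, by omega⟩
    · obtain rfl | rfl : i = 0 ∨ i = 1 := by omega
      · exact hx
      · exact hy
  · rw [T.zero_off _ hc, T'.zero_off _ hc]

theorem mem_descentSet (hB : IsTwoColumn n B) (hn : 4 ≤ n) (hs : B.size = n) (T : SYT B) (k : ℕ) :
    k ∈ T.descentSet ↔ (1 ≤ k ∧ k < n) ∧ k + 1 ≠ T.entry (0, 1) ∧
      (k + 1 ≠ T.entry (1, 1) ∨ T.entry (1, 1) = T.entry (0, 1) + 1) := by
  simp only [SYT.descentSet, Finset.mem_filter, Finset.mem_Ico, hs]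
  refine and_congr_right fun hk => ?_
  obtain ⟨c, hc, hck⟩ := T.exists_entry_eq_s18 hk.1 (hs ▸ hk.2.le)
  obtain ⟨c', hc', hck'⟩ := T.exists_entry_eq_s18 (k := k + 1) (by omega) (hs ▸ hk.2)
  have hdes : (∃ c ∈ B.cells, ∃ c' ∈ B.cells, T.entry c = k ∧ T.entry c' = k + 1 ∧ c.1 < c'.1) ↔
      c.1 < c'.1 := by
    constructor
    · rintro ⟨d, hd, d', hd', he, he', hlt⟩
      obtain rfl := T.injOn hd hc (he.trans hck.symm)
      obtain rfl := T.injOn hd' hc' (he'.trans hck'.symm)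
      exact hlt
    · exact fun h => ⟨c, hc, c', hc', hck, hck', h⟩
  rw [hdes]
  obtain ⟨h1, h2, h3, h4, h5, h6⟩ := hB.entry_basic hn hs T
  have hcol : ∀ i j, i ≤ n - 3 → j ≤ n - 3 → T.entry (i, 0) < T.entry (j, 0) → i < j := by
    intro i j hi hj h
    exact (hB.col_strictMono hn T).lt_iff_lt (a := ⟨i, by omega⟩) (b := ⟨j, by omega⟩) |>.1 h
  have hne : ∀ i, i ≤ n - 3 → T.entry (i, 0) ≠ T.entry (0, 1) ∧ T.entry (i, 0) ≠ T.entry (1, 1) := by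
    intro i hi
    have h : T.entry (i, 0) ∈ Set.range (fun i : Fin (n - 2) => T.entry (i, 0)) :=
      ⟨⟨i, by omega⟩, rfl⟩
    rw [hB.range_col hn hs] at h
    exact h.2
  obtain ⟨i, j⟩ := c
  obtain ⟨i', j'⟩ := c'
  dsimp only
  rcases (hB _ _).1 hc with ⟨hi, rfl⟩ | ⟨hi, rfl⟩ <;>
    rcases (hB _ _).1 hc' with ⟨hi', rfl⟩ | ⟨hi', rfl⟩
  · have := hcol i i' hi hi' (by omega)
    have := hne i' hi'
    omega
  · have := hne i hi
    obtain rfl | rfl : i' = 0 ∨ i' = 1 := by omega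
    · omega
    · have : i ≠ 0 := by
        rintro rfl
        omega
      omega
  · have := hne i' hi'
    obtain rfl | rfl : i = 0 ∨ i = 1 := by omega
    · have := hcol 0 i' (by omega) hi' (by omega)
      omega
    · have := hcol 1 i' (by omega) hi' (by omega)
      omega
  · obtain rfl | rfl : i = 0 ∨ i = 1 := by omega
    all_goals obtain rfl | rfl : i' = 0 ∨ i' = 1 := by omega
    all_goals omega

end IsTwoColumn

theorem countSYT_twoColumn_le_columnPlusRow {n : ℕ} (hn : 4 ≤ n) {A B : SkewShape}
    (hA : IsColumnPlusRow n A) (hB : IsTwoColumn n B) (hsA : A.size = n) (hsB : B.size = n)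
    (α : List ℕ) : countSYT B α ≤ countSYT A α := by
  let a (T : SYT B) : ℕ :=
    if T.entry (1, 1) = T.entry (0, 1) + 1 then 1 else T.entry (0, 1)
  let b (T : SYT B) : ℕ :=
    if T.entry (1, 1) = T.entry (0, 1) + 1 then T.entry (0, 1) else T.entry (1, 1)
  have hab (T : SYT B) : 1 ≤ a T ∧ a T < b T ∧ b T ≤ n := by
    have := hB.entry_basic hn hsB T
    simp only [a, b]
    split_ifs <;> omega
  refine countSYT_le_of_injective (hsB.trans hsA.symm)
    (fun T => pairSYT hA hsA (hab T).1 (hab T).2.1 (hab T).2.2) ?_ ?_ α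
  · intro T T' h
    have he : pairEntry n (a T) (b T) = pairEntry n (a T') (b T') := congrArg SYT.entry h
    have ha : a T = a T' := by simpa using congrFun he (0, 1)
    have hb : b T = b T' := by simpa using congrFun he (0, 2)
    have := hB.entry_basic hn hsB T
    have := hB.entry_basic hn hsB T'
    simp only [a, b] at ha hb
    apply hB.eq_of_second_col_eq hn hsB <;> split_ifs at ha hb <;> omega
  · intro T
    ext k
    rw [mem_descentSet_pairSYT, hB.mem_descentSet hn hsB]
    simp only [a, b]
    split_ifs <;> omega

theorem stmt18 (n : ℕ) (hn : 4 ≤ n) (A B : SkewShape)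
    (hA : A.cells = ({((0 : ℕ), (1 : ℕ)), ((0 : ℕ), (2 : ℕ))} : Finset (ℕ × ℕ)) ∪
      ((Finset.Icc 1 (n - 2)).image (fun i => (i, (0 : ℕ)))))
    (hB : B.cells = ((Finset.range 2).image (fun j => ((0 : ℕ), j))) ∪
      ((Finset.range 2).image (fun j => ((1 : ℕ), j))) ∪
      ((Finset.Icc 2 (n - 3)).image (fun i => (i, (0 : ℕ))))) :
    ∀ α : List ℕ, countSYT B α ≤ countSYT A α := by
  have hA' : IsColumnPlusRow n A := by
    intro i j
    simp only [hA, Finset.mem_union, Finset.mem_insert, Finset.mem_singleton, Finset.mem_image,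
      Finset.mem_Icc, Prod.mk.injEq]
    grind
  have hB' : IsTwoColumn n B := by
    intro i j
    simp only [hB, Finset.mem_union, Finset.mem_image, Finset.mem_range, Finset.mem_Icc,
      Prod.mk.injEq]
    constructor
    · rintro ((⟨k, hk, rfl, rfl⟩ | ⟨k, hk, rfl, rfl⟩) | ⟨k, hk, rfl, rfl⟩) <;> omega
    · intro h
      by_cases h0 : i = 0
      · exact Or.inl (Or.inl ⟨j, by omega⟩)
      by_cases h1 : i = 1
      · exact Or.inl (Or.inr ⟨j, by omega⟩)
      exact Or.inr ⟨i, by omega⟩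
  have hcol : Function.Injective fun i : ℕ => (i, 0) := Prod.mk_left_injective 0
  have hsA : A.size = n := by
    rw [SkewShape.size, hA, Finset.card_union_of_disjoint, Finset.card_image_of_injective _ hcol,
      Nat.card_Icc, Finset.card_pair (by simp)]
    · omega
    · simp [Finset.disjoint_left]
  have hsB : B.size = n := by
    have h : B.cells = (Finset.range (n - 2)).image (fun i => (i, 0)) ∪
        (Finset.range 2).image (fun i => (i, 1)) := by
      ext ⟨i, j⟩
      rw [hB']
      simp only [Finset.mem_union, Finset.mem_image, Finset.mem_range, Prod.mk.injEq]
      constructor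
      · rintro (⟨hi, rfl⟩ | ⟨hi, rfl⟩)
        · exact Or.inl ⟨i, by omega⟩
        · exact Or.inr ⟨i, by omega⟩
      · rintro (⟨k, hk, rfl, rfl⟩ | ⟨k, hk, rfl, rfl⟩) <;> omega
    rw [SkewShape.size, h, Finset.card_union_of_disjoint, Finset.card_image_of_injective _ hcol,
      Finset.card_image_of_injective _ (Prod.mk_left_injective 1), Finset.card_range,
      Finset.card_range]
    · omega
    · simp [Finset.disjoint_left]
  exact countSYT_twoColumn_le_columnPlusRow hn hA' hB' hsA hsB

end SkewPaper
end
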